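/- arXiv:2512.23134 — 2 statements merged into one kernel-verified Lean document; each statement's English description precedes it below -/
import Mathlib

section
/- Let α ∈ (0,1), γ ∈ (0,1), p ≥ 0, and let x ∈ ℝ^n be a nonzero vector with support Λ = supp(x) of cardinality s = ‖x‖₀, whose nonzero entries, reordered so that |x_{(1)}| ≥ ⋯ ≥ |x_{(s)}|, satisfy |x_{(i)}| ≥ s^p·i^{−p}·x_min for all i ∈ {1,…,s}, where x_min = min_{j∈Λ} |x_j|. Then γ(α·s − α√s + (1−α)·s^p·H_{s,p})·x_min + (1−γ)‖x‖₂² ≤ f_{α,γ}(x) ≤ γ(√s − α)‖x‖₂ + (1−γ)‖x‖₂². -/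
/-- The ℓ¹-norm of a vector in ℝ^n. -/
noncomputable def norm1 {n : ℕ} (x : Fin n → ℝ) : ℝ := ∑ i, |x i|

/-- The Euclidean (ℓ²) norm of a vector in ℝ^n. -/
noncomputable def norm2 {n : ℕ} (x : Fin n → ℝ) : ℝ := Real.sqrt (∑ i, (x i) ^ 2)

/-- The DCEN measure f_{α,γ}(x) = γ(‖x‖₁ − α‖x‖₂) + (1−γ)‖x‖₂². -/
noncomputable def fag {n : ℕ} (α γ : ℝ) (x : Fin n → ℝ) : ℝ :=
  γ * (norm1 x - α * norm2 x) + (1 - γ) * (norm2 x) ^ 2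

/-- The sum of squares of nonnegative reals is at most the square of their sum. -/
theorem sum_sq_le_sum_sq_of_nonneg {ι : Type*} (t : Finset ι) (f : ι → ℝ)
    (hf : ∀ i ∈ t, 0 ≤ f i) : ∑ i ∈ t, f i ^ 2 ≤ (∑ i ∈ t, f i) ^ 2 := by
  rw [sq (∑ i ∈ t, f i), Finset.sum_mul]
  refine Finset.sum_le_sum fun i hi => ?_
  rw [sq]
  exact mul_le_mul_of_nonneg_left (Finset.single_le_sum hf hi) (hf i hi)

/-- If all entries `f i`, `i ∈ t`, are at least `m ≥ 0`, then the gap between the `ℓ¹` and the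
`ℓ²` norm of `f` is at least `(#t - √#t) * m`. -/
theorem card_sub_sqrt_card_mul_le_sum_sub_sqrt {ι : Type*} (t : Finset ι) (ht : t.Nonempty)
    (f : ι → ℝ) (m : ℝ) (hm : 0 ≤ m) (hf : ∀ i ∈ t, m ≤ f i) :
    ((t.card : ℝ) - √t.card) * m ≤ ∑ i ∈ t, f i - √(∑ i ∈ t, f i ^ 2) := by
  have hY : 0 ≤ ∑ i ∈ t, (f i - m) := Finset.sum_nonneg fun i hi => sub_nonneg.2 (hf i hi)
  have hsq := sum_sq_le_sum_sq_of_nonneg t (fun i => f i - m) fun i hi => sub_nonneg.2 (hf i hi)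
  have hsum : ∑ i ∈ t, f i = ∑ i ∈ t, (f i - m) + t.card * m := by
    simp [Finset.sum_sub_distrib]
  have hexp : ∑ i ∈ t, f i ^ 2
      = ∑ i ∈ t, (f i - m) ^ 2 + 2 * m * ∑ i ∈ t, (f i - m) + t.card * m ^ 2 := by
    rw [Finset.mul_sum, ← nsmul_eq_mul, ← Finset.sum_const, ← Finset.sum_add_distrib,
      ← Finset.sum_add_distrib]
    exact Finset.sum_congr rfl fun i _ => by ring
  have hone : 1 ≤ √(t.card : ℝ) := Real.one_le_sqrt.2 (by exact_mod_cast ht.card_pos)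
  have hcard : √(t.card : ℝ) ^ 2 = t.card := Real.sq_sqrt (Nat.cast_nonneg _)
  have hnorm : √(∑ i ∈ t, f i ^ 2) ≤ ∑ i ∈ t, (f i - m) + √t.card * m := by
    refine Real.sqrt_le_iff.2 ⟨by positivity, ?_⟩
    have hcross := mul_le_mul_of_nonneg_left hone (mul_nonneg hm hY)
    have hsquare : (√(t.card : ℝ) * m) ^ 2 = t.card * m ^ 2 := by rw [mul_pow, hcard]
    rw [hexp, add_sq, hsquare]
    nlinarith
  linarith

/-- The sum of `f` over `t` is at most `√#t` times the `ℓ²` norm of `f` on `t`. -/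
theorem sum_le_sqrt_card_mul_sqrt_sum_sq {ι : Type*} (t : Finset ι) (f : ι → ℝ) :
    ∑ i ∈ t, f i ≤ √t.card * √(∑ i ∈ t, f i ^ 2) := by
  rw [← Real.sqrt_mul (Nat.cast_nonneg _)]
  exact Real.le_sqrt_of_sq_le sq_sum_le_card_mul_sum_sq

/-- For α, γ ∈ (0,1), p ≥ 0, and nonzero x ∈ ℝ^n with support Λ of
  cardinality s, whose nonzero entries enumerated decreasingly in absolute value (via an
  injection e : Fin s → Λ) satisfy |x_{e(i)}| ≥ s^p·i^{−p}·x_min with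
  x_min = min_{j∈Λ} |x_j|,
  γ(α·s − α√s + (1−α)·s^p·H_{s,p})·x_min + (1−γ)‖x‖₂² ≤ f_{α,γ}(x)
    ≤ γ(√s − α)‖x‖₂ + (1−γ)‖x‖₂². -/
theorem stmt4 {n : ℕ} (α γ p : ℝ) (hα : 0 < α) (hα1 : α < 1)
    (hγ : 0 < γ) (hγ1 : γ < 1) (hp : 0 ≤ p)
    (x : Fin n → ℝ) (hx : x ≠ 0)
    (Λ : Finset (Fin n)) (hΛ : Λ = Finset.univ.filter (fun i => x i ≠ 0))
    (s : ℕ) (hs : s = Λ.card)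
    (xmin : ℝ) (hxmin : IsLeast ((fun j => |x j|) '' (Λ : Set (Fin n))) xmin)
    (e : Fin s → Fin n) (he : Function.Injective e) (heΛ : ∀ i, e i ∈ Λ)
    (hsort : ∀ i j : Fin s, i ≤ j → |x (e j)| ≤ |x (e i)|)
    (hbound : ∀ i : Fin s, (s : ℝ) ^ p * (((i : ℕ) : ℝ) + 1) ^ (-p) * xmin ≤ |x (e i)|) :
    γ * (α * s - α * Real.sqrt s
        + (1 - α) * (s : ℝ) ^ p * ∑ i : Fin s, (((i : ℕ) : ℝ) + 1) ^ (-p)) * xmin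
      + (1 - γ) * (norm2 x) ^ 2 ≤ fag α γ x ∧
    fag α γ x ≤ γ * (Real.sqrt s - α) * norm2 x + (1 - γ) * (norm2 x) ^ 2 := by
  have hnorm1 : norm1 x = ∑ i ∈ Λ, |x i| := by
    rw [norm1, hΛ, Finset.sum_filter_of_ne fun i _ h => abs_ne_zero.1 h]
  have hnorm2 : norm2 x = √(∑ i ∈ Λ, |x i| ^ 2) := by
    simp_rw [norm2, sq_abs]
    rw [hΛ, Finset.sum_filter_of_ne fun i _ h => (pow_ne_zero_iff two_ne_zero).1 h]
  obtain ⟨⟨j, hj, hjmin⟩, hmin⟩ := hxmin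
  have hm : 0 ≤ xmin := hjmin ▸ abs_nonneg (x j)
  have hgap : ((s : ℝ) - √s) * xmin ≤ norm1 x - norm2 x := by
    rw [hnorm1, hnorm2, hs]
    exact card_sub_sqrt_card_mul_le_sum_sub_sqrt Λ ⟨j, hj⟩ _ xmin hm
      fun i hi => hmin ⟨i, hi, rfl⟩
  have hpow : (s : ℝ) ^ p * (∑ i : Fin s, (((i : ℕ) : ℝ) + 1) ^ (-p)) * xmin ≤ norm1 x := by
    rw [Finset.mul_sum, Finset.sum_mul]
    calc _ ≤ ∑ i : Fin s, |x (e i)| := Finset.sum_le_sum fun i _ => hbound i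
      _ = ∑ i ∈ Finset.univ.map ⟨e, he⟩, |x i| := by simp
      _ ≤ norm1 x := Finset.sum_le_univ_sum_of_nonneg fun i => abs_nonneg _
  have hupper : norm1 x ≤ √s * norm2 x := by
    rw [hnorm1, hnorm2, hs]
    exact sum_le_sqrt_card_mul_sqrt_sum_sq Λ fun i => |x i|
  unfold fag
  constructor
  · have hconv := add_le_add (mul_le_mul_of_nonneg_left hgap hα.le)
      (mul_le_mul_of_nonneg_left hpow (sub_nonneg.2 hα1.le))
    have hscaled := mul_le_mul_of_nonneg_left hconv hγ.le
    linarith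
  · have hscaled := mul_le_mul_of_nonneg_left hupper hγ.le
    linarith
end

section
/- Let λ > 0, γ ∈ (0,1), α ∈ [0,1], and y ∈ ℝ^n with ‖y‖∞ ≤ (1−α)γλ. Then every global minimizer x* of the proximal objective f_{γ,α}(x) = γ(‖x‖₁ − α‖x‖₂) + (1−γ)‖x‖₂² + (1/(2λ))‖x − y‖₂² equals the zero vector, x* = 0. -/
/-- The DCEN proximal objective
  f_{γ,α}(x) = γ(‖x‖₁ − α‖x‖₂) + (1−γ)‖x‖₂² + (1/(2λ))‖x − y‖₂². -/
noncomputable def proxObj {n : ℕ} (lam γ α : ℝ) (y x : Fin n → ℝ) : ℝ :=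
  γ * (norm1 x - α * norm2 x) + (1 - γ) * (norm2 x) ^ 2
    + (1 / (2 * lam)) * (norm2 (x - y)) ^ 2

theorem norm2_sq {n : ℕ} (x : Fin n → ℝ) : norm2 x ^ 2 = ∑ i, (x i) ^ 2 :=
  Real.sq_sqrt (Finset.sum_nonneg fun i _ => sq_nonneg (x i))

theorem norm2_le_norm1 {n : ℕ} (x : Fin n → ℝ) : norm2 x ≤ norm1 x := by
  refine Real.sqrt_le_iff.mpr ⟨Finset.sum_nonneg fun i _ => abs_nonneg (x i), ?_⟩
  have h := Finset.sum_sq_le_sq_sum_of_nonneg (s := Finset.univ) (f := fun i => |x i|)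
    fun i _ => abs_nonneg (x i)
  simpa only [sq_abs, norm1] using h

theorem norm2_sub_sq {n : ℕ} (x y : Fin n → ℝ) :
    norm2 (x - y) ^ 2 = norm2 x ^ 2 - 2 * ∑ i, x i * y i + norm2 y ^ 2 := by
  simp only [norm2_sq, Pi.sub_apply, sub_sq, Finset.sum_add_distrib, Finset.sum_sub_distrib,
    mul_assoc, Finset.mul_sum]

theorem sum_mul_le_mul_norm1 {n : ℕ} {c : ℝ} (x y : Fin n → ℝ) (hy : ∀ i, |y i| ≤ c) :
    ∑ i, x i * y i ≤ c * norm1 x := by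
  rw [norm1, Finset.mul_sum]
  refine Finset.sum_le_sum fun i _ => ?_
  calc x i * y i ≤ |x i * y i| := le_abs_self _
    _ = |y i| * |x i| := by rw [abs_mul, mul_comm]
    _ ≤ c * |x i| := mul_le_mul_of_nonneg_right (hy i) (abs_nonneg _)

theorem eq_zero_of_norm2_sq_eq_zero {n : ℕ} {x : Fin n → ℝ} (h : norm2 x ^ 2 = 0) : x = 0 := by
  rw [norm2_sq, Finset.sum_eq_zero_iff_of_nonneg fun i _ => sq_nonneg (x i)] at h
  funext i
  exact pow_eq_zero_iff two_ne_zero |>.mp (h i (Finset.mem_univ i))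

/-- If ‖y‖∞ ≤ (1−α)γλ (with α ∈ [0,1]), then every global minimizer of
  the DCEN proximal objective is the zero vector. -/
theorem stmt14 {n : ℕ} (lam γ α : ℝ) (hlam : 0 < lam)
    (hγ : 0 < γ) (hγ1 : γ < 1) (hα : 0 ≤ α) (hα1 : α ≤ 1)
    (y : Fin n → ℝ) (hy : ∀ i, |y i| ≤ (1 - α) * γ * lam)
    (xstar : Fin n → ℝ)
    (hmin : ∀ x : Fin n → ℝ, proxObj lam γ α y xstar ≤ proxObj lam γ α y x) :
    xstar = 0 := by
  have h0 := hmin 0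
  have hz : norm2 (0 : Fin n → ℝ) = 0 := by simp [norm2]
  have hz1 : norm1 (0 : Fin n → ℝ) = 0 := by simp [norm1]
  have hip := sum_mul_le_mul_norm1 xstar y hy
  have hle : γ * α * norm2 xstar ≤ γ * α * norm1 xstar :=
    mul_le_mul_of_nonneg_left (norm2_le_norm1 xstar) (by positivity)
  have hip' : 1 / lam * ∑ i, xstar i * y i ≤ (1 - α) * γ * norm1 xstar := by
    rw [one_div_mul_eq_div, div_le_iff₀ hlam]
    linarith
  have hsplit : 1 / (2 * lam) * (norm2 xstar ^ 2 - 2 * ∑ i, xstar i * y i + norm2 y ^ 2)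
      = 1 / (2 * lam) * norm2 xstar ^ 2 - 1 / lam * ∑ i, xstar i * y i
        + 1 / (2 * lam) * norm2 y ^ 2 := by
    field_simp
  simp only [proxObj, norm2_sub_sq, hz, hz1, Pi.zero_apply, zero_mul,
    Finset.sum_const_zero] at h0
  rw [hsplit] at h0
  have hpos : 0 < 1 - γ + 1 / (2 * lam) := by
    have : 0 < 1 / (2 * lam) := by positivity
    linarith
  refine eq_zero_of_norm2_sq_eq_zero (le_antisymm ?_ (sq_nonneg _))
  refine nonpos_of_mul_nonpos_right ?_ hpos
  linarith
end
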